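/- Let A be a complete NBW that is reverse deterministic, i.e., for every state q' ∈ Q and every letter a ∈ Σ there is at most one state q ∈ Q with q' ∈ δ(q, a). Then for every ω-word w the set of runs of A on w has at most |Q| elements; in particular, A is finitely ambiguous. -/

import Mathlib

open scoped Classical

/-- A nondeterministic Büchi automaton on ω-words with states `Q` over alphabet `σ`. -/
structure NBW (σ : Type) (Q : Type) where
  init : Set Q
  trans : Q → σ → Set Q
  acc : Set Q

namespace NBW

variable {σ Q : Type}

/-- `ρ` is a run of `A` on the ω-word `w`. -/
def IsRun (A : NBW σ Q) (w : ℕ → σ) (ρ : ℕ → Q) : Prop :=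
  ρ 0 ∈ A.init ∧ ∀ i, ρ (i + 1) ∈ A.trans (ρ i) (w i)

/-- `ρ` is an accepting run of `A` on `w`: it visits `A.acc` infinitely often. -/
def IsAccRun (A : NBW σ Q) (w : ℕ → σ) (ρ : ℕ → Q) : Prop :=
  A.IsRun w ρ ∧ ∀ n, ∃ m, n ≤ m ∧ ρ m ∈ A.acc

/-- The ω-language accepted by `A`. -/
def Lang (A : NBW σ Q) : Set (ℕ → σ) := {w | ∃ ρ, A.IsAccRun w ρ}

/-- `A` is complete: every state has a successor on every letter. -/
def Complete (A : NBW σ Q) : Prop := ∀ q a, (A.trans q a).Nonempty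

/-- `A` is finitely ambiguous: every accepted word has finitely many accepting runs. -/
def FinitelyAmbiguous (A : NBW σ Q) : Prop :=
  ∀ w ∈ A.Lang, {ρ | A.IsAccRun w ρ}.Finite

/-- `A` is limit deterministic with partition `(QN, QD)`. -/
def LimitDetPart (A : NBW σ Q) (QN QD : Set Q) : Prop :=
  Disjoint QN QD ∧ QN ∪ QD = Set.univ ∧ A.acc ⊆ QD ∧
    ∀ q ∈ QD, ∀ a, ∃ q' ∈ QD, A.trans q a = {q'}

/-- `A` is limit deterministic (for some partition). -/
def LimitDet (A : NBW σ Q) : Prop := ∃ QN QD, A.LimitDetPart QN QD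

end NBW

/-- A complete reverse deterministic NBW has at most `|Q|` runs on each ω-word;
in particular, it is finitely ambiguous. -/
theorem NBW.reverse_det_finitely_ambiguous (σ Q : Type) [Fintype σ] [Nonempty σ]
    [Fintype Q] (A : NBW σ Q) (hc : A.Complete)
    (hrd : ∀ (q' : Q) (a : σ), {q : Q | q' ∈ A.trans q a}.Subsingleton) :
    (∀ w : ℕ → σ, {ρ | A.IsRun w ρ}.Finite ∧
      {ρ | A.IsRun w ρ}.ncard ≤ Fintype.card Q) ∧
    A.FinitelyAmbiguous := by
  have back : ∀ (w : ℕ → σ) (ρ τ : ℕ → Q), A.IsRun w ρ → A.IsRun w τ →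
      ∀ n, ρ n = τ n → ∀ k, k ≤ n → ρ k = τ k := by
    intro w ρ τ hρ hτ n
    induction n with
    | zero =>
      intro h k hk
      obtain rfl : k = 0 := by omega
      exact h
    | succ n ih =>
      intro h k hk
      rcases Nat.lt_or_ge n k with hlt | hge
      · obtain rfl : k = n + 1 := by omega
        exact h
      · refine ih ?_ k hge
        have h1 := hρ.2 n
        rw [h] at h1
        exact hrd (τ (n + 1)) (w n) h1 (hτ.2 n)
  have key : ∀ (w : ℕ → σ) (s : Finset (ℕ → Q)), (∀ ρ ∈ s, A.IsRun w ρ) →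
      s.card ≤ Fintype.card Q := by
    intro w s hs
    have hd : ∀ p : (ℕ → Q) × (ℕ → Q), ∃ n, p.1 ≠ p.2 → p.1 n ≠ p.2 n := by
      intro p
      by_cases h : p.1 = p.2
      · exact ⟨0, fun h' => absurd h h'⟩
      · obtain ⟨n, hn⟩ := Function.ne_iff.mp h
        exact ⟨n, fun _ => hn⟩
    choose d hd using hd
    have hinj : Set.InjOn (fun ρ : ℕ → Q => ρ ((s ×ˢ s).sup d)) (s : Set (ℕ → Q)) := by
      intro ρ hρ τ hτ h
      by_contra hne
      have hmem : (ρ, τ) ∈ s ×ˢ s := Finset.mem_product.mpr ⟨hρ, hτ⟩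
      exact hd (ρ, τ) hne
        (back w ρ τ (hs ρ hρ) (hs τ hτ) _ h _ (Finset.le_sup (f := d) hmem))
    rw [← Finset.card_image_of_injOn hinj]
    exact Finset.card_le_univ _
  have fin : ∀ w : ℕ → σ, {ρ | A.IsRun w ρ}.Finite := by
    intro w
    by_contra hinf
    obtain ⟨t, ht, hcard⟩ :=
      Set.Infinite.exists_subset_card_eq hinf (Fintype.card Q + 1)
    have := key w t (fun ρ hρ => ht hρ)
    omega
  refine ⟨fun w => ⟨fin w, ?_⟩, fun w _ => (fin w).subset fun ρ hρ => hρ.1⟩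
  rw [Set.ncard_eq_toFinset_card _ (fin w)]
  exact key w _ (fun ρ hρ => by simpa using hρ)
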